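/- Let N = 6, m ≥ 2, and let (λ̄, u^{m−1}) solve the overdetermined radial problem, with u^{m−1} nondegenerate, and let v̄₀ be as in the context with ū^{m−1} = −u^{m−1}. Fix σ > 0 and for ε ≠ 0 and d ∈ (σ, 1/σ) set δ = |ε|·d and W_δ(x) = ū^{m−1}(|x|) + ε·v̄₀(|x|) − PU_δ(x) for x in the unit ball B ⊂ ℝ⁶. Then there exist c > 0 and ε₀ > 0 such that for all ε with 0 < |ε| < ε₀ and all d ∈ (σ, 1/σ): ( ∫_B | ΔW_δ(x) + |W_δ(x)|·W_δ(x) + (λ̄+ε)·W_δ(x) |^{3/2} dx )^{2/3} ≤ c·ε²·|ln|ε||^{2/3}. -/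

import Mathlib

open Real Set Filter Topology MeasureTheory


/-- `(lamBar, w)` solves the overdetermined radial problem in dimension `6`:
`w'' + (5/r)w' + |w|w + lamBar·w = 0` on `(0,1)`, `w'(0) = 0`, `w(1) = 0`,
`w(0) = -lamBar/2`, and `w` has exactly `m - 1` nodal zones (`m - 2` zeros in `(0,1)`). -/
structure OverdetSol (lamBar : ℝ) (m : ℕ) (w w' w'' : ℝ → ℝ) : Prop where
  lam_pos : 0 < lamBar
  deriv_fst : ∀ r ∈ Set.Icc (0:ℝ) 1, HasDerivWithinAt w (w' r) (Set.Icc (0:ℝ) 1) r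
  deriv_snd : ∀ r ∈ Set.Icc (0:ℝ) 1, HasDerivWithinAt w' (w'' r) (Set.Icc (0:ℝ) 1) r
  ode : ∀ r ∈ Set.Ioo (0:ℝ) 1, w'' r + (5 / r) * w' r + |w r| * w r + lamBar * w r = 0
  bc_deriv_zero : w' 0 = 0
  bc_one : w 1 = 0
  val_zero : w 0 = -lamBar / 2
  nodal : {r : ℝ | r ∈ Set.Ioo (0:ℝ) 1 ∧ w r = 0}.ncard = m - 2

/-- Nondegeneracy of a solution `w` of the overdetermined problem: the only radial
solution of the linearized equation with Dirichlet boundary conditions is the trivial one. -/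
def Nondeg (lamBar : ℝ) (w : ℝ → ℝ) : Prop :=
  ∀ v v' v'' : ℝ → ℝ,
    (∀ r ∈ Set.Icc (0:ℝ) 1, HasDerivWithinAt v (v' r) (Set.Icc (0:ℝ) 1) r) →
    (∀ r ∈ Set.Icc (0:ℝ) 1, HasDerivWithinAt v' (v'' r) (Set.Icc (0:ℝ) 1) r) →
    (∀ r ∈ Set.Ioo (0:ℝ) 1, v'' r + (5 / r) * v' r + (2 * |w r| + lamBar) * v r = 0) →
    v' 0 = 0 → v 1 = 0 → ∀ r ∈ Set.Icc (0:ℝ) 1, v r = 0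

/-- Radial profile of the standard bubble `U_δ` in dimension `6`. -/
noncomputable def Urad (δ r : ℝ) : ℝ := 24 * δ ^ 2 / (δ ^ 2 + r ^ 2) ^ 2

/-- Radial profile of the projection `PU_δ` of the standard bubble onto `H¹₀(B)`,
`B` the unit ball of `ℝ⁶`: `-Δ PU_δ = U_δ²` in `B`, `PU_δ = 0` on `∂B`. -/
noncomputable def PUrad (δ r : ℝ) : ℝ :=
  24 * δ ^ 2 * (1 / (δ ^ 2 + r ^ 2) ^ 2 - 1 / (δ ^ 2 + 1) ^ 2)


lemma aux_tri (a P : ℝ) (hP : 0 ≤ P) :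
    |(|a - P| * (a - P) + P ^ 2 - |a| * a)| ≤ 2 * |a| * P := by
  rcases le_total 0 a with ha | ha
  · rw [abs_of_nonneg ha]
    rcases le_total P a with h | h
    · rw [abs_of_nonneg (sub_nonneg.2 h), abs_le]
      constructor <;> nlinarith [mul_nonneg ha hP, mul_nonneg hP (sub_nonneg.2 h)]
    · rw [abs_of_nonpos (sub_nonpos.2 h), abs_le]
      constructor <;> nlinarith [mul_nonneg ha hP, mul_nonneg ha (sub_nonneg.2 h)]
  · rw [abs_of_nonpos ha, abs_of_nonpos (by linarith : a - P ≤ 0), abs_le]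
    constructor <;> nlinarith [mul_nonneg (neg_nonneg.2 ha) hP]

lemma aux_taylor (u h : ℝ) :
    |(|u + h| * (u + h) - |u| * u - 2 * |u| * h)| ≤ h ^ 2 := by
  rcases le_total 0 u with hu | hu
  · rw [abs_of_nonneg hu]
    rcases le_total 0 (u + h) with h1 | h1
    · rw [abs_of_nonneg h1, abs_le]
      constructor <;> nlinarith
    · rw [abs_of_nonpos h1, abs_le]
      constructor <;> nlinarith [mul_nonneg hu (neg_nonneg.2 h1), sq_nonneg (u + h), sq_nonneg u]
  · rw [abs_of_nonpos hu]
    rcases le_total 0 (u + h) with h1 | h1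
    · rw [abs_of_nonneg h1, abs_le]
      constructor <;> nlinarith [mul_nonneg (neg_nonneg.2 hu) h1, sq_nonneg (u + h), sq_nonneg u]
    · rw [abs_of_nonpos h1, abs_le]
      constructor <;> nlinarith

/-- Pointwise estimate of the error by the bubble. -/
lemma aux_pointwise (lam M σ δ ε r u v lw lv W : ℝ) (hlam : 0 < lam) (hσ : 0 < σ)
    (hδ : 0 < δ) (hδ1 : δ < 1) (hσδ : σ * |ε| ≤ δ) (hε : |ε| ≤ 1) (hr : 0 < r) (hr1 : r < 1)
    (hu : |u| ≤ M) (hv : |v| ≤ M)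
    (h1 : lw + |u| * u + lam * u = 0)
    (h2 : lv + (2 * |u| + lam) * v + u = 0)
    (hW : W = -u - ε * v - PUrad δ r) :
    |(-lw + ε * (-lv) + (Urad δ r) ^ 2 + |W| * W + (lam + ε) * W)|
      ≤ ((M + M ^ 2) / σ ^ 2 + lam + 49 + 4 * M) * Urad δ r := by
  have hM : 0 ≤ M := (abs_nonneg u).trans hu
  set U := Urad δ r with hU
  set P := PUrad δ r with hP
  set c := 24 * δ ^ 2 / (δ ^ 2 + 1) ^ 2 with hc
  have hUP : U = P + c := by
    rw [hU, hP, hc, Urad, PUrad]; ring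
  have hc0 : 0 ≤ c := by positivity
  have hc24 : c ≤ 24 := by
    rw [hc, div_le_iff₀ (by positivity)]; nlinarith [sq_nonneg (δ^2)]
  have hcU : c ≤ U := by
    rw [hc, hU, Urad]
    have : r ^ 2 ≤ 1 := by nlinarith
    gcongr
  have hcl : 6 * δ ^ 2 ≤ c := by
    rw [hc, le_div_iff₀ (by positivity)]
    have h2 : δ ^ 2 + 1 ≤ 2 := by nlinarith
    have : (δ ^ 2 + 1) ^ 2 ≤ 2 ^ 2 := by gcongr
    nlinarith [sq_nonneg δ]
  have hU0 : 0 ≤ U := hc0.trans hcU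
  have hP0 : 0 ≤ P := by linarith
  have hPU : P ≤ U := by linarith
  have heps : ε ^ 2 ≤ U / σ ^ 2 := by
    rw [le_div_iff₀ (by positivity)]
    have : (σ * |ε|) ^ 2 ≤ δ ^ 2 := by gcongr
    rw [mul_pow, sq_abs] at this
    nlinarith [sq_nonneg δ]
  have hεv : |ε * v| ≤ M := by
    rw [abs_mul]; nlinarith [abs_nonneg ε, abs_nonneg v]
  have ha : |-u - ε * v| ≤ 2 * M := by
    calc |-u - ε * v| ≤ |-u| + |ε * v| := abs_sub _ _
      _ ≤ 2 * M := by rw [abs_neg]; linarith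
  have key : -lw + ε * (-lv) + U ^ 2 + |W| * W + (lam + ε) * W
      = -(ε ^ 2 * v) + (-((lam + ε) * P)) + (U ^ 2 - P ^ 2)
        + (|-u - ε * v - P| * (-u - ε * v - P) + P ^ 2 - |-u - ε * v| * (-u - ε * v))
        + (|-u + -(ε * v)| * (-u + -(ε * v)) - |-u| * (-u) - 2 * |-u| * (-(ε * v))) := by
    have e1 : lw = -(|u| * u + lam * u) := by linarith
    have e2 : lv = -((2 * |u| + lam) * v + u) := by linarith
    rw [hW, e1, e2, abs_neg, ← sub_eq_add_neg (-u) (ε * v)]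
    ring
  have b1 : |-(ε ^ 2 * v)| ≤ M * (U / σ ^ 2) := by
    rw [abs_neg, abs_mul, abs_of_nonneg (sq_nonneg ε), mul_comm]
    gcongr
  have b2 : |-((lam + ε) * P)| ≤ (lam + 1) * U := by
    rw [abs_neg, abs_mul, abs_of_nonneg hP0]
    have : |lam + ε| ≤ lam + 1 := by
      calc _ ≤ |lam| + |ε| := abs_add_le _ _
        _ ≤ _ := by rw [abs_of_pos hlam]; linarith
    gcongr
  have b3 : |U ^ 2 - P ^ 2| ≤ 48 * U := by
    have e : U ^ 2 - P ^ 2 = c * (U + P) := by rw [hUP]; ring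
    rw [e, abs_of_nonneg (by positivity)]
    calc c * (U + P) ≤ 24 * (U + U) := by gcongr
      _ = _ := by ring
  have b4 := aux_tri (-u - ε * v) P hP0
  have b4' : 2 * |-u - ε * v| * P ≤ 4 * M * U := by
    have : 2 * |-u - ε * v| * P ≤ 2 * (2 * M) * U := by gcongr
    linarith
  have b5 := aux_taylor (-u) (-(ε * v))
  have b5' : (-(ε * v)) ^ 2 ≤ M ^ 2 * (U / σ ^ 2) := by
    have : v ^ 2 ≤ M ^ 2 := by rw [← sq_abs v]; gcongr
    calc (-(ε * v)) ^ 2 = v ^ 2 * ε ^ 2 := by ring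
      _ ≤ _ := by gcongr
  rw [key]
  have fin : ((M + M ^ 2) / σ ^ 2 + lam + 49 + 4 * M) * U = M * (U / σ ^ 2) + (lam + 1) * U + 48 * U
      + 4 * M * U + M ^ 2 * (U / σ ^ 2) := by ring
  rw [fin]
  refine (abs_add_le _ _).trans (add_le_add ?_ (b5.trans b5'))
  refine (abs_add_le _ _).trans (add_le_add ?_ (b4.trans b4'))
  refine (abs_add_le _ _).trans (add_le_add ?_ b3)
  exact (abs_add_le _ _).trans (add_le_add b1 b2)

lemma aux_1d (δ : ℝ) (hδ : 0 < δ) (hδ1 : δ < 1) :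
    ∫ r in (0:ℝ)..1, r ^ 5 / (δ ^ 2 + r ^ 2) ^ 3 ≤ 1 - Real.log δ := by
  have hpos : ∀ r : ℝ, 0 < δ ^ 2 + r ^ 2 := fun r => by positivity
  have h1 : ∫ r in (0:ℝ)..1, r ^ 5 / (δ ^ 2 + r ^ 2) ^ 3
      ≤ ∫ r in (0:ℝ)..1, r / (δ ^ 2 + r ^ 2) := by
    apply intervalIntegral.integral_mono_on (by norm_num)
    · apply Continuous.intervalIntegrable
      exact Continuous.div (by fun_prop) (by fun_prop) (fun r => (pow_pos (hpos r) 3).ne')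
    · apply Continuous.intervalIntegrable
      exact Continuous.div (by fun_prop) (by fun_prop) (fun r => (hpos r).ne')
    · intro r hr
      rw [div_le_div_iff₀ (pow_pos (hpos r) 3) (hpos r)]
      have h4 : r ^ 4 ≤ (δ ^ 2 + r ^ 2) ^ 2 := by nlinarith [sq_nonneg δ, sq_nonneg r, mul_nonneg (sq_nonneg δ) (sq_nonneg r), sq_nonneg (δ^2)]
      have := mul_le_mul_of_nonneg_left h4 (mul_nonneg hr.1 (hpos r).le)
      nlinarith
  have h2 : ∫ r in (0:ℝ)..1, r / (δ ^ 2 + r ^ 2)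
      = Real.log (δ ^ 2 + 1 ^ 2) / 2 - Real.log (δ ^ 2 + 0 ^ 2) / 2 := by
    apply intervalIntegral.integral_eq_sub_of_hasDerivAt (f := fun r => Real.log (δ ^ 2 + r ^ 2) / 2)
    · intro r _
      have h : HasDerivAt (fun r : ℝ => δ ^ 2 + r ^ 2) (2 * r) r := by
        simpa using (hasDerivAt_pow 2 r).const_add (δ ^ 2)
      have h' := (h.log (hpos r).ne').div_const 2
      have he : 2 * r / (δ ^ 2 + r ^ 2) / 2 = r / (δ ^ 2 + r ^ 2) := by ring
      rwa [he] at h'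
    · apply Continuous.intervalIntegrable
      exact Continuous.div (by fun_prop) (by fun_prop) (fun r => (hpos r).ne')
  have h3 : Real.log (δ ^ 2 + 1 ^ 2) ≤ 1 := by
    have := Real.log_le_sub_one_of_pos (hpos 1)
    nlinarith
  have h4 : Real.log (δ ^ 2 + 0 ^ 2) = 2 * Real.log δ := by
    simp
  rw [h4] at h2
  refine h1.trans ?_
  rw [h2]
  generalize Real.log (δ ^ 2 + 1 ^ 2) = L at h3 ⊢
  generalize Real.log δ = L'
  linarith

lemma aux_ball : ∃ C > (0:ℝ), ∀ δ : ℝ, 0 < δ → δ < 1 →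
    ∫ x in Metric.ball (0 : EuclideanSpace ℝ (Fin 6)) 1, 1 / (δ ^ 2 + ‖x‖ ^ 2) ^ 3
      ≤ C * (1 - Real.log δ) := by
  set b := (volume : Measure (EuclideanSpace ℝ (Fin 6))).real (Metric.ball 0 1) with hb
  refine ⟨6 * b + 1, by positivity, fun δ hδ hδ1 => ?_⟩
  have hlog : Real.log δ < 0 := Real.log_neg hδ hδ1
  have e : ∫ x in Metric.ball (0 : EuclideanSpace ℝ (Fin 6)) 1, 1 / (δ ^ 2 + ‖x‖ ^ 2) ^ 3
      = 6 * b * ∫ r in (0:ℝ)..1, r ^ 5 / (δ ^ 2 + r ^ 2) ^ 3 := by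
    rw [← integral_indicator measurableSet_ball]
    have e1 : ∀ x : EuclideanSpace ℝ (Fin 6),
        (Metric.ball (0 : EuclideanSpace ℝ (Fin 6)) 1).indicator
          (fun x => 1 / (δ ^ 2 + ‖x‖ ^ 2) ^ 3) x
        = (Set.Iio (1:ℝ)).indicator (fun r => 1 / (δ ^ 2 + r ^ 2) ^ 3) ‖x‖ := by
      intro x
      simp [Set.indicator]
    simp_rw [e1]
    rw [integral_fun_norm_addHaar volume
      ((Set.Iio (1:ℝ)).indicator (fun r => 1 / (δ ^ 2 + r ^ 2) ^ 3))]
    rw [intervalIntegral.integral_of_le (by norm_num), integral_Ioc_eq_integral_Ioo]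
    have e2 : ∀ y : ℝ, y ^ (Module.finrank ℝ (EuclideanSpace ℝ (Fin 6)) - 1) •
        (Set.Iio (1:ℝ)).indicator (fun r => 1 / (δ ^ 2 + r ^ 2) ^ 3) y
        = (Set.Iio (1:ℝ)).indicator (fun r => r ^ 5 / (δ ^ 2 + r ^ 2) ^ 3) y := by
      intro y
      by_cases h : y < 1 <;> simp [Set.indicator, h, div_eq_mul_inv]
    simp_rw [e2]
    rw [setIntegral_indicator measurableSet_Iio, Set.Ioi_inter_Iio]
    simp [← hb]
    ring
  rw [e]
  have h0 : 0 ≤ 6 * b := by positivity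
  nlinarith [mul_le_mul_of_nonneg_left (aux_1d δ hδ hδ1) h0]

theorem statement14 (m : ℕ) (hm : 2 ≤ m)
    (lamBar : ℝ) (w w' w'' : ℝ → ℝ) (hw : OverdetSol lamBar m w w' w'')
    (hnd : Nondeg lamBar w)
    (v₀ v₀' v₀'' : ℝ → ℝ)
    (hv₀d1 : ∀ r ∈ Set.Icc (0:ℝ) 1, HasDerivWithinAt v₀ (v₀' r) (Set.Icc (0:ℝ) 1) r)
    (hv₀d2 : ∀ r ∈ Set.Icc (0:ℝ) 1, HasDerivWithinAt v₀' (v₀'' r) (Set.Icc (0:ℝ) 1) r)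
    (hv₀ode : ∀ r ∈ Set.Ioo (0:ℝ) 1,
      v₀'' r + (5 / r) * v₀' r + (2 * |w r| + lamBar) * v₀ r + w r = 0)
    (hv₀bc0 : v₀' 0 = 0) (hv₀bc1 : v₀ 1 = 0)
    (σ : ℝ) (hσ : 0 < σ) :
    ∃ c > (0:ℝ), ∃ ε₀ > (0:ℝ), ∀ ε : ℝ, ε ≠ 0 → |ε| < ε₀ →
      ∀ d : ℝ, σ < d → d < 1 / σ →
        ∀ W : ℝ → ℝ, (∀ ρ : ℝ, W ρ = -(w ρ) - ε * v₀ ρ - PUrad (|ε| * d) ρ) →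
          (∫ x in Metric.ball (0 : EuclideanSpace ℝ (Fin 6)) 1,
              abs ((-(w'' ‖x‖) - (5 / ‖x‖) * w' ‖x‖) +
                ε * (-(v₀'' ‖x‖) - (5 / ‖x‖) * v₀' ‖x‖) +
                (Urad (|ε| * d) ‖x‖) ^ 2 +
                |W ‖x‖| * W ‖x‖ + (lamBar + ε) * W ‖x‖) ^ ((3:ℝ)/2)) ^ ((2:ℝ)/3)
            ≤ c * ε ^ 2 * (abs (Real.log |ε|)) ^ ((2:ℝ)/3) := by
  obtain ⟨M1, hM1⟩ := isCompact_Icc.exists_bound_of_continuousOn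
    (fun r hr => (hw.deriv_fst r hr).continuousWithinAt)
  obtain ⟨M2, hM2⟩ := isCompact_Icc.exists_bound_of_continuousOn
    (fun r hr => (hv₀d1 r hr).continuousWithinAt)
  obtain ⟨C, hC, hball⟩ := aux_ball
  set M := max M1 M2 with hM
  have hM0 : 0 ≤ M := ((norm_nonneg _).trans (hM1 0 (by simp))).trans (le_max_left _ _)
  have hlam := hw.lam_pos
  set K := (M + M ^ 2) / σ ^ 2 + lamBar + 49 + 4 * M with hK
  have hK0 : 0 < K := by positivity
  set A := (24 * K) ^ ((3:ℝ)/2) * (1 / σ) ^ 3 * (C * (2 + |Real.log σ|)) with hA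
  have hA0 : 0 < A := by positivity
  refine ⟨A ^ ((2:ℝ)/3), by positivity, min σ (Real.exp (-1)), by positivity, ?_⟩
  intro ε hε0 hεlt d hd1 hd2 W hW
  have hεpos : 0 < |ε| := abs_pos.2 hε0
  have hεσ : |ε| < σ := hεlt.trans_le (min_le_left _ _)
  have hεe : |ε| < Real.exp (-1) := hεlt.trans_le (min_le_right _ _)
  have hε1 : |ε| ≤ 1 := hεe.le.trans (Real.exp_le_one_iff.2 (by norm_num))
  have hL : Real.log |ε| ≤ -1 := by
    rw [Real.log_le_iff_le_exp hεpos]; exact hεe.le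
  have hLabs : (abs (Real.log |ε|)) = -Real.log |ε| := abs_of_nonpos (by linarith)
  have hd0 : 0 < d := hσ.trans hd1
  set δ := |ε| * d with hδdef
  have hδ : 0 < δ := by positivity
  have hδ1 : δ < 1 := by
    calc |ε| * d < σ * (1 / σ) := by gcongr
      _ = 1 := by field_simp
  have hδ2 : δ ≤ |ε| * (1 / σ) := by rw [hδdef]; gcongr
  have hσδ : σ * |ε| ≤ δ := by rw [hδdef, mul_comm]; gcongr
  have hI : (∫ x in Metric.ball (0 : EuclideanSpace ℝ (Fin 6)) 1,
              abs ((-(w'' ‖x‖) - (5 / ‖x‖) * w' ‖x‖) +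
                ε * (-(v₀'' ‖x‖) - (5 / ‖x‖) * v₀' ‖x‖) +
                (Urad δ ‖x‖) ^ 2 +
                |W ‖x‖| * W ‖x‖ + (lamBar + ε) * W ‖x‖) ^ ((3:ℝ)/2))
      ≤ ∫ x in Metric.ball (0 : EuclideanSpace ℝ (Fin 6)) 1,
          (24 * K) ^ ((3:ℝ)/2) * δ ^ 3 * (1 / (δ ^ 2 + ‖x‖ ^ 2) ^ 3) := by
    apply integral_mono_of_nonneg
    · exact Filter.Eventually.of_forall fun x => by positivity
    · apply Integrable.const_mul
      have hc : Continuous fun x : EuclideanSpace ℝ (Fin 6) => 1 / (δ ^ 2 + ‖x‖ ^ 2) ^ 3 :=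
        Continuous.div (by fun_prop) (by fun_prop) (fun x => by positivity)
      exact (hc.continuousOn.integrableOn_compact (isCompact_closedBall 0 1)).mono_set
        Metric.ball_subset_closedBall
    · have hne : ∀ᵐ x : EuclideanSpace ℝ (Fin 6)
          ∂(volume.restrict (Metric.ball (0 : EuclideanSpace ℝ (Fin 6)) 1)), x ≠ 0 :=
        ae_restrict_of_ae (Measure.ae_ne volume 0)
      filter_upwards [hne, ae_restrict_mem measurableSet_ball] with x hx0 hx
      have hr : 0 < ‖x‖ := norm_pos_iff.2 hx0
      have hr1 : ‖x‖ < 1 := by simpa using hx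
      have hIcc : ‖x‖ ∈ Set.Icc (0:ℝ) 1 := ⟨hr.le, hr1.le⟩
      have hp := aux_pointwise lamBar M σ δ ε ‖x‖ (w ‖x‖) (v₀ ‖x‖)
        (w'' ‖x‖ + (5 / ‖x‖) * w' ‖x‖) (v₀'' ‖x‖ + (5 / ‖x‖) * v₀' ‖x‖) (W ‖x‖)
        hlam hσ hδ hδ1 hσδ hε1 hr hr1
        ((hM1 _ hIcc).trans (le_max_left _ _)) ((hM2 _ hIcc).trans (le_max_right _ _))
        (hw.ode _ ⟨hr, hr1⟩) (hv₀ode _ ⟨hr, hr1⟩) (hW _)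
      rw [neg_add', neg_add'] at hp
      calc _ ≤ (K * Urad δ ‖x‖) ^ ((3:ℝ)/2) := Real.rpow_le_rpow (abs_nonneg _) hp (by norm_num)
        _ = _ := by
          have hq : K * Urad δ ‖x‖ = (24 * K) * (δ / (δ ^ 2 + ‖x‖ ^ 2)) ^ 2 := by
            rw [Urad, div_pow]; ring
          have h0 : 0 ≤ δ / (δ ^ 2 + ‖x‖ ^ 2) := by positivity
          rw [hq, Real.mul_rpow (by positivity) (by positivity), ← Real.rpow_natCast _ 2,
            ← Real.rpow_mul h0]
          have : ((2:ℕ):ℝ) * ((3:ℝ)/2) = ((3:ℕ):ℝ) := by norm_num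
          rw [this, Real.rpow_natCast, div_pow]
          ring
  have hI2 : ∫ x in Metric.ball (0 : EuclideanSpace ℝ (Fin 6)) 1,
          (24 * K) ^ ((3:ℝ)/2) * δ ^ 3 * (1 / (δ ^ 2 + ‖x‖ ^ 2) ^ 3)
      ≤ A * |ε| ^ 3 * (abs (Real.log |ε|)) := by
    rw [integral_const_mul]
    have hlogδ : 1 - Real.log δ ≤ (2 + |Real.log σ|) * (abs (Real.log |ε|)) := by
      have h1 : Real.log (σ * |ε|) ≤ Real.log δ := Real.log_le_log (by positivity) hσδ
      rw [Real.log_mul hσ.ne' hεpos.ne'] at h1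
      have h2 := neg_abs_le (Real.log σ)
      rw [hLabs]
      nlinarith [abs_nonneg (Real.log σ)]
    calc _ ≤ (24 * K) ^ ((3:ℝ)/2) * (|ε| * (1 / σ)) ^ 3 *
          (C * ((2 + |Real.log σ|) * (abs (Real.log |ε|)))) := by
          gcongr
          exact (hball δ hδ hδ1).trans (by gcongr)
      _ = _ := by rw [hA]; ring
  refine (Real.rpow_le_rpow (integral_nonneg fun x => by positivity) (hI.trans hI2)
    (by norm_num)).trans (le_of_eq ?_)
  rw [Real.mul_rpow (by positivity) (by positivity), Real.mul_rpow (by positivity) (by positivity),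
    ← Real.rpow_natCast _ 3, ← Real.rpow_mul hεpos.le]
  have : ((3:ℕ):ℝ) * ((2:ℝ)/3) = ((2:ℕ):ℝ) := by norm_num
  rw [this, Real.rpow_natCast, sq_abs]
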